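/- arXiv:2303.10981 — 6 statements merged into one kernel-verified Lean document; each statement's English description precedes it below -/
import Mathlib

section
/- Fix dimensions n, m ∈ ℕ. Let F ∈ ℝⁿ (the closed-loop drift f_cl(x) at a fixed state x), G ∈ ℝⁿˣᵐ (the input matrix g(x)), s ∈ ℝⁿ (the gradient ∇S_cl(x) of the closed-loop storage function), w ∈ ℝⁿ (the gradient ∇h(x) of the CBF), and α_val ∈ ℝ (the value α(h(x))). Define d_p := −⟨s, F⟩ and assume d_p ≥ 0 (passivity of the nominal closed loop), define the output y := Gᵀ s, b := Gᵀ w and assume b ≠ 0, define Ψ := ⟨w, F⟩ + α_val, and define the safety-filter correction ν := 0 if Ψ ≥ 0 and ν := −(Ψ/‖b‖²)·b if Ψ < 0. Then the filtered dissipation inequality (∀ ν̄ ∈ ℝᵐ, ⟨s, F + G(ν + ν̄)⟩ ≤ ⟨y, ν̄⟩) holds if and only if (Ψ < 0 → −(⟨y, b⟩/‖b‖²)·Ψ ≤ d_p). -/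
open Matrix

/-- **Theorem 2 (pointwise), passivity preservation.**
At a fixed state, with closed-loop drift `F = f_cl(x)`, input matrix `G = g(x)`,
storage-function gradient `s = ∇S_cl(x)`, CBF gradient `w = ∇h(x)` and
`α_val = α(h(x))`, the safety-filtered dissipation inequality holds for all
external inputs `ν̄` iff the injected power is bounded by the nominal
dissipation `d_p` whenever `Ψ < 0`. -/
theorem passivity_preserving_safety_filter_iff
    (n m : ℕ) (F : Fin n → ℝ) (G : Matrix (Fin n) (Fin m) ℝ)
    (s w : Fin n → ℝ) (α_val : ℝ)
    (d_p : ℝ) (hd_p : d_p = -(s ⬝ᵥ F)) (hd_p_nonneg : 0 ≤ d_p)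
    (y : Fin m → ℝ) (hy : y = Gᵀ *ᵥ s)
    (b : Fin m → ℝ) (hb : b = Gᵀ *ᵥ w) (hb_ne : b ≠ 0)
    (Ψ : ℝ) (hΨ : Ψ = w ⬝ᵥ F + α_val)
    (ν : Fin m → ℝ)
    (hν : ν = if Ψ < 0 then (-(Ψ / (b ⬝ᵥ b))) • b else 0) :
    (∀ νbar : Fin m → ℝ, s ⬝ᵥ (F + G *ᵥ (ν + νbar)) ≤ y ⬝ᵥ νbar) ↔
      (Ψ < 0 → -((y ⬝ᵥ b) / (b ⬝ᵥ b)) * Ψ ≤ d_p) := by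
  have power : ∀ νbar : Fin m → ℝ,
      s ⬝ᵥ (F + G *ᵥ (ν + νbar)) = -d_p + y ⬝ᵥ ν + y ⬝ᵥ νbar := by
    intro νbar
    rw [dotProduct_add, dotProduct_mulVec, ← mulVec_transpose, ← hy, dotProduct_add, hd_p]
    ring
  have reduce : (∀ νbar : Fin m → ℝ, s ⬝ᵥ (F + G *ᵥ (ν + νbar)) ≤ y ⬝ᵥ νbar) ↔
      y ⬝ᵥ ν ≤ d_p := by
    simp only [power]
    exact ⟨fun h => by linarith [h 0], fun h νbar => by linarith⟩
  rw [reduce, hν]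
  split_ifs with hneg
  · have : y ⬝ᵥ ((-(Ψ / (b ⬝ᵥ b))) • b) = -((y ⬝ᵥ b) / (b ⬝ᵥ b)) * Ψ := by
      rw [dotProduct_smul, smul_eq_mul]
      ring
    rw [this, forall_prop_of_true hneg]
  · simp [hneg, hd_p_nonneg]
end

section
/- Consider a mechanical port-Hamiltonian closed-loop system on ℝⁿ × ℝⁿ with state (q,p), storage function S_cl(q,p) = ½⟨p, M(q)⁻¹p⟩ + Vᵗ(q), unforced vector field f_cl(q,p) = (∂S_cl/∂p, −∂S_cl/∂q − D ∂S_cl/∂p), and output y(q,p) = Bᵀ M(q)⁻¹ p. Let h(q,p) = −½⟨p, M(q)⁻¹p⟩ + α_E·h̄(q) + Ē be a generalised energy-based candidate CBF and α : ℝ → ℝ continuous, strictly increasing with α(0) = 0. Fix (q,p) with Bᵀ M(q)⁻¹ p ≠ 0, let Ψ := ⟨∇h(q,p), f_cl(q,p)⟩ + α(h(q,p)), and when Ψ < 0 let ν := −(Ψ/‖Bᵀ ∂h/∂p‖²)·(Bᵀ ∂h/∂p) be the safety-filter correction. Then the injected power satisfies ⟨y(q,p), ν⟩ = Ψ. -/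
open Matrix

attribute [local instance] Matrix.normedAddCommGroup Matrix.normedSpace

/-- The Euclidean gradient of a scalar function on `ℝⁿ`, as a vector. -/
noncomputable def gradVec {n : ℕ} (φ : (Fin n → ℝ) → ℝ) (z : Fin n → ℝ) :
    Fin n → ℝ :=
  fun i => fderiv ℝ φ z (Pi.single i 1)

/-- Partial gradient `∂φ/∂q` of a function of `(q,p)`. -/
noncomputable def gradq {n : ℕ} (φ : (Fin n → ℝ) → (Fin n → ℝ) → ℝ)
    (q p : Fin n → ℝ) : Fin n → ℝ :=
  gradVec (fun q' => φ q' p) q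

/-- Partial gradient `∂φ/∂p` of a function of `(q,p)`. -/
noncomputable def gradp {n : ℕ} (φ : (Fin n → ℝ) → (Fin n → ℝ) → ℝ)
    (q p : Fin n → ℝ) : Fin n → ℝ :=
  gradVec (φ q) p

/-- Directional derivative `⟨∇φ(q,p), v⟩` of a function of the full state. -/
noncomputable def gradFull {n : ℕ} (φ : (Fin n → ℝ) → (Fin n → ℝ) → ℝ)
    (q p : Fin n → ℝ) (v : (Fin n → ℝ) × (Fin n → ℝ)) : ℝ :=
  fderiv ℝ (fun z : (Fin n → ℝ) × (Fin n → ℝ) => φ z.1 z.2) (q, p) v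

/-- Closed-loop storage function `S_cl(q,p) = ½⟨p, M(q)⁻¹p⟩ + Vᵗ(q)`. -/
noncomputable def Scl {n : ℕ} (M : (Fin n → ℝ) → Matrix (Fin n) (Fin n) ℝ)
    (Vt : (Fin n → ℝ) → ℝ) (q p : Fin n → ℝ) : ℝ :=
  (1 / 2) * (p ⬝ᵥ ((M q)⁻¹ *ᵥ p)) + Vt q

/-- Unforced closed-loop vector field
`f_cl(q,p) = (∂S_cl/∂p, −∂S_cl/∂q − D ∂S_cl/∂p)`. -/
noncomputable def fcl {n : ℕ} (M : (Fin n → ℝ) → Matrix (Fin n) (Fin n) ℝ)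
    (Vt : (Fin n → ℝ) → ℝ) (D : Matrix (Fin n) (Fin n) ℝ) (q p : Fin n → ℝ) :
    (Fin n → ℝ) × (Fin n → ℝ) :=
  (gradp (Scl M Vt) q p,
    -(gradq (Scl M Vt) q p) - D *ᵥ gradp (Scl M Vt) q p)

theorem hasFDerivAt_dotProduct_mulVec {n : ℕ} (A : Matrix (Fin n) (Fin n) ℝ) (p : Fin n → ℝ) :
    HasFDerivAt (fun p : Fin n → ℝ => p ⬝ᵥ (A *ᵥ p))
      (∑ i, (p i • (ContinuousLinearMap.proj i ∘L A.mulVecLin.toContinuousLinearMap) +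
        (A *ᵥ p) i • (ContinuousLinearMap.proj i : (Fin n → ℝ) →L[ℝ] ℝ))) p := by
  refine HasFDerivAt.fun_sum fun i _ => ?_
  exact (ContinuousLinearMap.proj (R := ℝ) (φ := fun _ : Fin n => ℝ) i).hasFDerivAt.mul
    ((ContinuousLinearMap.proj (R := ℝ) (φ := fun _ : Fin n => ℝ) i) ∘L
      A.mulVecLin.toContinuousLinearMap).hasFDerivAt

theorem gradVec_neg_half_quadratic_add_const {n : ℕ} {A : Matrix (Fin n) (Fin n) ℝ}
    (hA : A.IsSymm) (b c : ℝ) (p : Fin n → ℝ) :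
    gradVec (fun p => -((1 / 2) * (p ⬝ᵥ (A *ᵥ p))) + b + c) p = -(A *ᵥ p) := by
  funext i
  have hd := ((((hasFDerivAt_dotProduct_mulVec A p).const_mul (1 / 2)).fun_neg).add_const
    b).add_const c
  have hcol : ∑ j, p j * A j i = (A *ᵥ p) i := by
    simp only [mulVec, dotProduct]
    exact Finset.sum_congr rfl fun j _ => by rw [hA.apply, mul_comm]
  rw [gradVec, hd.fderiv]
  simp [Finset.sum_add_distrib, Pi.single_apply, hcol]
  ring

/-- **Corollary 1 (first part).** For a generalised energy-based candidate CBF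
`h(q,p) = −½⟨p, M(q)⁻¹p⟩ + α_E h̄(q) + Ē` on a mechanical port-Hamiltonian
closed loop, the power injected by the active safety filter equals the
constraint value `Ψ`. -/
theorem injected_power_eq_constraint_for_energy_CBF
    (n : ℕ) (M : (Fin n → ℝ) → Matrix (Fin n) (Fin n) ℝ)
    (hM : ContDiff ℝ 1 M) (hMpd : ∀ q, (M q).PosDef)
    (Vt : (Fin n → ℝ) → ℝ) (hVt : ContDiff ℝ 1 Vt)
    (hbar : (Fin n → ℝ) → ℝ) (hhbar : ContDiff ℝ 1 hbar)
    (D B : Matrix (Fin n) (Fin n) ℝ) (hD : D.PosSemidef) (hB : IsUnit B.det)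
    (αE Ebar : ℝ) (hEbar : 0 ≤ Ebar)
    (α : ℝ → ℝ) (hαc : Continuous α) (hαm : StrictMono α) (hα0 : α 0 = 0)
    (h : (Fin n → ℝ) → (Fin n → ℝ) → ℝ)
    (hdef : h = fun q p =>
      -((1 / 2) * (p ⬝ᵥ ((M q)⁻¹ *ᵥ p))) + αE * hbar q + Ebar)
    (q p : Fin n → ℝ)
    (y : Fin n → ℝ) (hy : y = Bᵀ *ᵥ ((M q)⁻¹ *ᵥ p)) (hy_ne : y ≠ 0)
    (Ψ : ℝ) (hΨ : Ψ = gradFull h q p (fcl M Vt D q p) + α (h q p))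
    (hΨneg : Ψ < 0)
    (ν : Fin n → ℝ)
    (hν : ν = (-(Ψ / ((Bᵀ *ᵥ gradp h q p) ⬝ᵥ (Bᵀ *ᵥ gradp h q p)))) •
      (Bᵀ *ᵥ gradp h q p)) :
    y ⬝ᵥ ν = Ψ := by
  have hgrad : gradp h q p = -((M q)⁻¹ *ᵥ p) := by
    have hsymm : ((M q)⁻¹).IsSymm := by
      simpa [IsHermitian, IsSymm] using (hMpd q).isHermitian.inv
    subst hdef
    exact gradVec_neg_half_quadratic_add_const hsymm _ _ p
  have hBgrad : Bᵀ *ᵥ gradp h q p = -y := by rw [hgrad, mulVec_neg, hy]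
  have hyy : y ⬝ᵥ y ≠ 0 := fun h0 => hy_ne (dotProduct_self_eq_zero.mp h0)
  rw [hν, hBgrad]
  simp only [neg_dotProduct, dotProduct_neg, neg_neg, dotProduct_smul, smul_eq_mul]
  field_simp
end

section
/- Consider a mechanical port-Hamiltonian closed-loop system on ℝⁿ × ℝⁿ with state (q,p), storage function S_cl(q,p) = ½⟨p, M(q)⁻¹p⟩ + Vᵗ(q), unforced vector field f_cl(q,p) = (∂S_cl/∂p, −∂S_cl/∂q − D ∂S_cl/∂p), and output y(q,p) = Bᵀ M(q)⁻¹ p. Let h(q,p) = −½⟨p, M(q)⁻¹p⟩ + α_E·h̄(q) + Ē and α : ℝ → ℝ continuous, strictly increasing with α(0) = 0. For each (q,p) let Ψ(q,p) := ⟨∇h(q,p), f_cl(q,p)⟩ + α(h(q,p)) and define the safety correction ν(q,p) := 0 if Ψ(q,p) ≥ 0 and ν(q,p) := −(Ψ(q,p)/‖Bᵀ∂h/∂p‖²)·(Bᵀ∂h/∂p) if Ψ(q,p) < 0 (assume Bᵀ M(q)⁻¹ p ≠ 0 at every point where Ψ(q,p) < 0). Then for every (q,p) and every external input ν̄ ∈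 ℝⁿ, the filtered system satisfies the passivity inequality ⟨∇S_cl(q,p), f_cl(q,p) + (0, B(ν(q,p) + ν̄))⟩ ≤ ⟨y(q,p), ν̄⟩. -/
open Matrix

attribute [local instance] Matrix.normedAddCommGroup Matrix.normedSpace

theorem gradVec_dotProduct {n : ℕ} (φ : (Fin n → ℝ) → ℝ) (z v : Fin n → ℝ) :
    gradVec φ z ⬝ᵥ v = fderiv ℝ φ z v := by
  have := LinearMap.pi_apply_eq_sum_univ (fderiv ℝ φ z).toLinearMap v
  simp only [ContinuousLinearMap.coe_coe, smul_eq_mul] at this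
  rw [this, dotProduct]
  refine Finset.sum_congr rfl fun i _ => ?_
  rw [mul_comm, gradVec]
  congr 3
  ext j
  simp [Pi.single_apply, eq_comm]

theorem differentiable_det_of_entries {E : Type*} [NormedAddCommGroup E] [NormedSpace ℝ E]
    {n : ℕ} {A : E → Matrix (Fin n) (Fin n) ℝ}
    (hA : ∀ i j, Differentiable ℝ fun x => A x i j) :
    Differentiable ℝ fun x => (A x).det := by
  simp only [Matrix.det_apply']
  fun_prop

theorem differentiable_inv_entry {E : Type*} [NormedAddCommGroup E] [NormedSpace ℝ E]
    {n : ℕ} {A : E → Matrix (Fin n) (Fin n) ℝ}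
    (hA : ∀ i j, Differentiable ℝ fun x => A x i j) (hdet : ∀ x, (A x).det ≠ 0)
    (i j : Fin n) : Differentiable ℝ fun x => (A x)⁻¹ i j := by
  simp only [Matrix.inv_def, Ring.inverse_eq_inv', Matrix.smul_apply, smul_eq_mul,
    Matrix.adjugate_apply]
  refine ((differentiable_det_of_entries hA).inv hdet).mul
    (differentiable_det_of_entries fun k l => ?_)
  by_cases hk : k = j
  · subst hk
    simp
  · simpa [Matrix.updateRow_ne hk] using hA k l

/-- The differential of a function of `(q,p)` splits into its partial gradients. -/
theorem gradFull_eq_add {n : ℕ} {φ : (Fin n → ℝ) → (Fin n → ℝ) → ℝ} {q p : Fin n → ℝ}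
    (hφ : DifferentiableAt ℝ
      (fun z : (Fin n → ℝ) × (Fin n → ℝ) => φ z.1 z.2) (q, p))
    (v : (Fin n → ℝ) × (Fin n → ℝ)) :
    gradFull φ q p v = gradq φ q p ⬝ᵥ v.1 + gradp φ q p ⬝ᵥ v.2 := by
  have hq := (hφ.hasFDerivAt.comp q (hasFDerivAt_prodMk_left (𝕜 := ℝ) q p)).fderiv
  have hp := (hφ.hasFDerivAt.comp p (hasFDerivAt_prodMk_right (𝕜 := ℝ) q p)).fderiv
  simp only [Function.comp_def] at hq hp
  rw [gradq, gradp, gradVec_dotProduct, gradVec_dotProduct, hq, hp, gradFull]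
  simp only [ContinuousLinearMap.comp_apply, ContinuousLinearMap.inl_apply,
    ContinuousLinearMap.inr_apply]
  rw [← map_add]
  simp

theorem gradVec_const_mul_quadratic_add_const {n : ℕ} {A : Matrix (Fin n) (Fin n) ℝ}
    (hA : A.IsSymm) (a c : ℝ) (p : Fin n → ℝ) :
    gradVec (fun p => a * (p ⬝ᵥ (A *ᵥ p)) + c) p = (2 * a) • (A *ᵥ p) := by
  have hd : DifferentiableAt ℝ (fun p : Fin n → ℝ => a * (p ⬝ᵥ (A *ᵥ p)) + c) p := by
    simp only [dotProduct, mulVec]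
    fun_prop
  ext i
  rw [gradVec, ← hd.lineDeriv_eq_fderiv]
  set e : Fin n → ℝ := Pi.single i 1 with he
  have hsymm : p ⬝ᵥ (A *ᵥ e) = e ⬝ᵥ (A *ᵥ p) := by
    rw [dotProduct_mulVec, ← mulVec_transpose, hA.eq, dotProduct_comm]
  have hexpand : (fun t : ℝ => a * ((p + t • e) ⬝ᵥ (A *ᵥ (p + t • e))) + c) =
      fun t : ℝ => a * (p ⬝ᵥ (A *ᵥ p)) + c + 2 * a * (e ⬝ᵥ (A *ᵥ p)) * t +
        a * (e ⬝ᵥ (A *ᵥ e)) * t ^ 2 := by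
    ext t
    simp only [mulVec_add, mulVec_smul, add_dotProduct, dotProduct_add, smul_dotProduct,
      dotProduct_smul, smul_eq_mul, hsymm]
    ring
  have hderiv : HasDerivAt (fun t : ℝ => a * (p ⬝ᵥ (A *ᵥ p)) + c +
      2 * a * (e ⬝ᵥ (A *ᵥ p)) * t + a * (e ⬝ᵥ (A *ᵥ e)) * t ^ 2)
      (2 * a * (e ⬝ᵥ (A *ᵥ p))) 0 := by
    have := (((hasDerivAt_id (0 : ℝ)).const_mul (2 * a * (e ⬝ᵥ (A *ᵥ p)))).const_add
      (a * (p ⬝ᵥ (A *ᵥ p)) + c)).add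
      ((hasDerivAt_pow 2 (0 : ℝ)).const_mul (a * (e ⬝ᵥ (A *ᵥ e))))
    exact this.congr_deriv (by simp)
  rw [lineDeriv, hexpand, hderiv.deriv]
  simp [he, mul_assoc]

theorem differentiable_Scl {n : ℕ} {M : (Fin n → ℝ) → Matrix (Fin n) (Fin n) ℝ}
    (hM : ∀ i j, Differentiable ℝ fun q => M q i j) (hdet : ∀ q, (M q).det ≠ 0)
    {Vt : (Fin n → ℝ) → ℝ} (hVt : Differentiable ℝ Vt) :
    Differentiable ℝ (fun z : (Fin n → ℝ) × (Fin n → ℝ) => Scl M Vt z.1 z.2) := by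
  have hinv (i j) : Differentiable ℝ
      fun z : (Fin n → ℝ) × (Fin n → ℝ) => (M z.1)⁻¹ i j :=
    (differentiable_inv_entry hM hdet i j).comp differentiable_fst
  have hp (i) : Differentiable ℝ fun z : (Fin n → ℝ) × (Fin n → ℝ) => z.2 i :=
    differentiable_pi.1 differentiable_snd i
  refine Differentiable.add (.const_mul (.fun_sum fun i _ => ?_) _)
    (hVt.comp differentiable_fst)
  refine (hp i).mul ?_
  simp only [mulVec, dotProduct]
  exact .fun_sum fun j _ => (hinv i j).fun_mul (hp j)

/-- Power balance of the closed loop under an input force `u`. -/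
theorem gradFull_Scl_fcl_add {n : ℕ} {M : (Fin n → ℝ) → Matrix (Fin n) (Fin n) ℝ}
    {Vt : (Fin n → ℝ) → ℝ} {q p : Fin n → ℝ}
    (hS : DifferentiableAt ℝ
      (fun z : (Fin n → ℝ) × (Fin n → ℝ) => Scl M Vt z.1 z.2) (q, p))
    (D : Matrix (Fin n) (Fin n) ℝ) (u : Fin n → ℝ) :
    gradFull (Scl M Vt) q p (fcl M Vt D q p + (0, u)) =
      -(gradp (Scl M Vt) q p ⬝ᵥ (D *ᵥ gradp (Scl M Vt) q p)) +
        gradp (Scl M Vt) q p ⬝ᵥ u := by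
  rw [gradFull_eq_add hS]
  simp only [fcl, Prod.mk_add_mk, add_zero, dotProduct_add, dotProduct_sub, dotProduct_neg]
  rw [dotProduct_comm (gradq (Scl M Vt) q p)]
  ring

/-- **Corollary 1 (main conclusion).** Every generalised energy-based candidate
CBF `h(q,p) = −½⟨p, M(q)⁻¹p⟩ + α_E h̄(q) + Ē` induces a passivity-preserving
safety-critical filtering: for every state `(q,p)` and every external input
`ν̄`, the filtered closed loop satisfies the passivity inequality
`⟨∇S_cl, f_cl + (0, B(ν + ν̄))⟩ ≤ ⟨y, ν̄⟩` with `y = Bᵀ M(q)⁻¹ p`. -/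
theorem energy_CBF_filter_preserves_passivity
    (n : ℕ) (M : (Fin n → ℝ) → Matrix (Fin n) (Fin n) ℝ)
    (hM : ContDiff ℝ 1 M) (hMpd : ∀ q, (M q).PosDef)
    (Vt : (Fin n → ℝ) → ℝ) (hVt : ContDiff ℝ 1 Vt)
    (hbar : (Fin n → ℝ) → ℝ) (hhbar : ContDiff ℝ 1 hbar)
    (D B : Matrix (Fin n) (Fin n) ℝ) (hD : D.PosSemidef) (hB : IsUnit B.det)
    (αE Ebar : ℝ) (hEbar : 0 ≤ Ebar)
    (α : ℝ → ℝ) (hαc : Continuous α) (hαm : StrictMono α) (hα0 : α 0 = 0)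
    (h : (Fin n → ℝ) → (Fin n → ℝ) → ℝ)
    (hdef : h = fun q p =>
      -((1 / 2) * (p ⬝ᵥ ((M q)⁻¹ *ᵥ p))) + αE * hbar q + Ebar)
    (Ψ : (Fin n → ℝ) → (Fin n → ℝ) → ℝ)
    (hΨ : ∀ q p, Ψ q p = gradFull h q p (fcl M Vt D q p) + α (h q p))
    (ν : (Fin n → ℝ) → (Fin n → ℝ) → Fin n → ℝ)
    (hν : ∀ q p, ν q p = if Ψ q p < 0 then
        (-(Ψ q p / ((Bᵀ *ᵥ gradp h q p) ⬝ᵥ (Bᵀ *ᵥ gradp h q p)))) •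
          (Bᵀ *ᵥ gradp h q p)
      else 0)
    (hreg : ∀ q p, Ψ q p < 0 → Bᵀ *ᵥ ((M q)⁻¹ *ᵥ p) ≠ 0) :
    ∀ (q p νbar : Fin n → ℝ),
      gradFull (Scl M Vt) q p (fcl M Vt D q p + (0, B *ᵥ (ν q p + νbar))) ≤
        (Bᵀ *ᵥ ((M q)⁻¹ *ᵥ p)) ⬝ᵥ νbar := by
  intro q p νbar
  have hsymm : ((M q)⁻¹).IsSymm := by
    simpa [Matrix.IsSymm, Matrix.IsHermitian, conjTranspose_eq_transpose_of_trivial]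
      using (hMpd q).isHermitian.inv
  have hS : gradp (Scl M Vt) q p = (M q)⁻¹ *ᵥ p := by
    refine (gradVec_const_mul_quadratic_add_const hsymm (1 / 2) (Vt q) p).trans ?_
    norm_num
  have hh : gradp h q p = -((M q)⁻¹ *ᵥ p) := by
    have := gradVec_const_mul_quadratic_add_const hsymm (-(1 / 2)) (αE * hbar q + Ebar) p
    simp only [neg_mul, ← add_assoc] at this
    rw [gradp, hdef]
    refine this.trans ?_
    norm_num
  have hentry (i j) : Differentiable ℝ fun q => M q i j :=
    differentiable_pi.1 (differentiable_pi.1 (hM.differentiable one_ne_zero) i) j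
  rw [gradFull_Scl_fcl_add (differentiable_Scl hentry
    (fun q => (hMpd q).det_pos.ne') (hVt.differentiable one_ne_zero) (q, p)), hS]
  set w := (M q)⁻¹ *ᵥ p
  have hdiss : 0 ≤ w ⬝ᵥ (D *ᵥ w) := by simpa using hD.dotProduct_mulVec_nonneg w
  have hcorr : (Bᵀ *ᵥ w) ⬝ᵥ ν q p ≤ 0 := by
    rw [hν, hh]
    split_ifs with hneg
    · have hpos : (Bᵀ *ᵥ w) ⬝ᵥ (Bᵀ *ᵥ w) ≠ 0 := 
        dotProduct_self_eq_zero.not.2 (hreg q p hneg)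
      simp only [mulVec_neg, neg_dotProduct, dotProduct_neg, neg_neg, dotProduct_smul,
        smul_eq_mul, neg_smul, smul_neg]
      rw [div_mul_cancel₀ _ hpos]
      exact hneg.le
    · simp
  rw [dotProduct_mulVec w B, ← mulVec_transpose, dotProduct_add]
  linarith
end

section
/- Let n, m ∈ ℕ, let J, R : ℝⁿ → ℝⁿˣⁿ be continuous with J(z) skew-symmetric and R(z) symmetric positive semidefinite for every z, let g : ℝⁿ → ℝⁿˣᵐ be continuous, and let H, V̄ : ℝⁿ → ℝ be C¹. Assume the matching conditions: for all z, g(z)ᵀ∇V̄(z) = 0, R(z)∇V̄(z) = 0, and there exists β(z) ∈ ℝᵐ with g(z)β(z) = J(z)∇V̄(z). Let ν : [0,T) → ℝᵐ be continuous and let x : [0,T) → ℝⁿ be differentiable with x'(t) = (J(x(t)) − R(x(t)))∇H(x(t)) + g(x(t))(β(x(t)) + ν(t)). Then, with S_cl := H + V̄, for every t: d/dt S_cl(x(t)) = ⟨g(x(t))ᵀ∇H(x(t)), ν(t)⟩ − ⟨∇H(x(t)), R(x(t))∇H(x(t))⟩ ≤ ⟨y(t), ν(t)⟩, where y(t) :=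 g(x(t))ᵀ∇H(x(t)). -/
open Matrix

theorem fderiv_apply_eq_gradVec_dotProduct {n : ℕ} (φ : (Fin n → ℝ) → ℝ) (z v : Fin n → ℝ) :
    fderiv ℝ φ z v = gradVec φ z ⬝ᵥ v := by
  conv_lhs => rw [pi_eq_sum_univ' v]
  simp only [map_sum, map_smul, smul_eq_mul, gradVec, dotProduct]
  exact Finset.sum_congr rfl fun i _ => mul_comm _ _

theorem dotProduct_mulVec_of_transpose_eq_neg {n : ℕ} {A : Matrix (Fin n) (Fin n) ℝ}
    (hA : Aᵀ = -A) (a b : Fin n → ℝ) : b ⬝ᵥ (A *ᵥ a) = -(a ⬝ᵥ (A *ᵥ b)) := by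
  rw [dotProduct_mulVec, ← mulVec_transpose, hA, neg_mulVec, neg_dotProduct, dotProduct_comm]

/-- The power balance of the closed loop at a point, with `a` and `b` the gradients of the
natural and of the added energy. -/
theorem closed_loop_power_balance {n m : ℕ} {J R : Matrix (Fin n) (Fin n) ℝ}
    {G : Matrix (Fin n) (Fin m) ℝ} {a b : Fin n → ℝ} {u v : Fin m → ℝ}
    (hJ : Jᵀ = -J) (hR : Rᵀ = R) (hGb : Gᵀ *ᵥ b = 0) (hRb : R *ᵥ b = 0)
    (hu : G *ᵥ u = J *ᵥ b) :
    a ⬝ᵥ ((J - R) *ᵥ a + G *ᵥ (u + v)) + b ⬝ᵥ ((J - R) *ᵥ a + G *ᵥ (u + v))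
      = (Gᵀ *ᵥ a) ⬝ᵥ v - a ⬝ᵥ (R *ᵥ a) := by
  have hJa : a ⬝ᵥ (J *ᵥ a) = 0 := by
    linarith [dotProduct_mulVec_of_transpose_eq_neg hJ a a]
  have hJab := dotProduct_mulVec_of_transpose_eq_neg hJ a b
  have hRa : b ⬝ᵥ (R *ᵥ a) = 0 := by
    rw [dotProduct_mulVec, ← mulVec_transpose, hR, hRb, zero_dotProduct]
  have hGv : b ⬝ᵥ (G *ᵥ v) = 0 := by
    rw [dotProduct_mulVec, ← mulVec_transpose, hGb, zero_dotProduct]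
  have hJb : b ⬝ᵥ (J *ᵥ b) = 0 := by
    linarith [dotProduct_mulVec_of_transpose_eq_neg hJ b b]
  have hy : a ⬝ᵥ (G *ᵥ v) = (Gᵀ *ᵥ a) ⬝ᵥ v := by
    rw [dotProduct_mulVec, ← mulVec_transpose]
  simp only [sub_mulVec, mulVec_add, hu, dotProduct_add, dotProduct_sub]
  linarith

/-- **Theorem 3 (EB-PBC for port-Hamiltonian systems).** If the added energy
`V̄` satisfies the matching conditions `gᵀ∇V̄ = 0`, `R∇V̄ = 0` and
`g β = J ∇V̄`, then along every solution of the closed loop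
`ẋ = (J(x) − R(x))∇H(x) + g(x)(β(x) + ν)` on `[0,T)` the storage function
`S_cl = H + V̄` satisfies
`d/dt S_cl(x(t)) = ⟨y(t), ν(t)⟩ − ⟨∇H, R∇H⟩ ≤ ⟨y(t), ν(t)⟩`,
with `y = gᵀ∇H`. -/
theorem EBPBC_closed_loop_passive
    (n m : ℕ)
    (J R : (Fin n → ℝ) → Matrix (Fin n) (Fin n) ℝ)
    (hJc : Continuous J) (hRc : Continuous R)
    (hJ : ∀ z, (J z)ᵀ = -(J z)) (hR : ∀ z, (R z).PosSemidef)
    (g : (Fin n → ℝ) → Matrix (Fin n) (Fin m) ℝ) (hgc : Continuous g)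
    (H Vbar : (Fin n → ℝ) → ℝ) (hH : ContDiff ℝ 1 H) (hVbar : ContDiff ℝ 1 Vbar)
    (hmatch1 : ∀ z, (g z)ᵀ *ᵥ gradVec Vbar z = 0)
    (hmatch2 : ∀ z, R z *ᵥ gradVec Vbar z = 0)
    (β : (Fin n → ℝ) → Fin m → ℝ)
    (hmatch3 : ∀ z, g z *ᵥ β z = J z *ᵥ gradVec Vbar z)
    (T : EReal) (hT : 0 < T)
    (Dom : Set ℝ) (hDom : Dom = {t : ℝ | 0 ≤ t ∧ (t : EReal) < T})
    (ν : ℝ → Fin m → ℝ) (hν : ContinuousOn ν Dom)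
    (x : ℝ → Fin n → ℝ)
    (hx : ∀ t ∈ Dom, HasDerivWithinAt x
      ((J (x t) - R (x t)) *ᵥ gradVec H (x t) + g (x t) *ᵥ (β (x t) + ν t))
      Dom t) :
    ∀ t ∈ Dom,
      HasDerivWithinAt (fun τ => H (x τ) + Vbar (x τ))
        (((g (x t))ᵀ *ᵥ gradVec H (x t)) ⬝ᵥ ν t
          - gradVec H (x t) ⬝ᵥ (R (x t) *ᵥ gradVec H (x t))) Dom t ∧
      ((g (x t))ᵀ *ᵥ gradVec H (x t)) ⬝ᵥ ν t
          - gradVec H (x t) ⬝ᵥ (R (x t) *ᵥ gradVec H (x t))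
        ≤ ((g (x t))ᵀ *ᵥ gradVec H (x t)) ⬝ᵥ ν t := by
  intro t ht
  have hchain {φ : (Fin n → ℝ) → ℝ} (hφ : ContDiff ℝ 1 φ) :=
    ((hφ.differentiable one_ne_zero (x t)).hasFDerivAt).comp_hasDerivWithinAt t (hx t ht)
  refine ⟨?_, ?_⟩
  · have hsum := (hchain hH).add (hchain hVbar)
    rw [fderiv_apply_eq_gradVec_dotProduct, fderiv_apply_eq_gradVec_dotProduct,
      closed_loop_power_balance (hJ _) (by simpa using (hR (x t)).isHermitian.eq)
        (hmatch1 _) (hmatch2 _) (hmatch3 _)] at hsum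
    exact hsum
  · have hdiss := (hR (x t)).dotProduct_mulVec_nonneg (gradVec H (x t))
    rw [star_trivial] at hdiss
    linarith
end

section
/- Let α : ℝ → ℝ be locally Lipschitz, strictly increasing, and satisfy α(0) = 0. Let h : ℝⁿ → ℝ be C¹ and let f : ℝⁿ → ℝⁿ be a locally Lipschitz (closed-loop) vector field such that ⟨∇h(z), f(z)⟩ ≥ −α(h(z)) for all z ∈ ℝⁿ. Let T ∈ (0, ∞] and let x : [0,T) → ℝⁿ be differentiable with x'(t) = f(x(t)) for all t and h(x(0)) ≥ 0. Then h(x(t)) ≥ 0 for all t ∈ [0,T); i.e., the safe set C = {z : h(z) ≥ 0} is forward invariant. -/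
/-- A function on `[a, b]` that starts nonnegative and has positive right derivative wherever it is
negative stays nonnegative. -/
theorem nonneg_of_deriv_right_pos_of_neg {y y' : ℝ → ℝ} {a b : ℝ}
    (hy : ContinuousOn y (Set.Icc a b))
    (hy' : ∀ s ∈ Set.Ico a b, HasDerivWithinAt y (y' s) (Set.Ici s) s)
    (ha : 0 ≤ y a) (hpos : ∀ s ∈ Set.Ico a b, y s < 0 → 0 < y' s) :
    ∀ s ∈ Set.Icc a b, 0 ≤ y s := by
  intro s hs
  refine le_of_forall_pos_le_add fun ε hε => ?_
  have hfence : -y s ≤ ε :=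
    image_le_of_deriv_right_lt_deriv_boundary (f := fun r => -y r) (f' := fun r => -y' r)
      (B := fun _ => ε) (B' := fun _ => 0) hy.neg (fun r hr => (hy' r hr).neg)
      (by linarith) (fun r => hasDerivAt_const r ε)
      (fun r hr hrε => neg_neg_of_pos (hpos r hr (by linarith))) hs
  linarith

/-- **Theorem 1 (CBF forward invariance).** If `h` is `C¹`, the closed-loop
vector field `f` is locally Lipschitz and satisfies the barrier condition
`⟨∇h(z), f(z)⟩ ≥ −α(h(z))` for a locally Lipschitz, strictly increasing `α`
with `α(0) = 0`, then along any solution `x` of `ẋ = f(x)` on `[0,T)`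
(`T ∈ (0,∞]`) starting in the safe set `{h ≥ 0}`, one has `h(x(t)) ≥ 0` for
all `t ∈ [0,T)`. -/
theorem cbf_forward_invariance
    (n : ℕ) (α : ℝ → ℝ)
    (hαlip : LocallyLipschitz α) (hαm : StrictMono α) (hα0 : α 0 = 0)
    (h : (Fin n → ℝ) → ℝ) (hh : ContDiff ℝ 1 h)
    (f : (Fin n → ℝ) → Fin n → ℝ) (hf : LocallyLipschitz f)
    (hcbf : ∀ z, fderiv ℝ h z (f z) ≥ -α (h z))
    (T : EReal) (hT : 0 < T)
    (Dom : Set ℝ) (hDom : Dom = {t : ℝ | 0 ≤ t ∧ (t : EReal) < T})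
    (x : ℝ → Fin n → ℝ)
    (hx : ∀ t ∈ Dom, HasDerivWithinAt x (f (x t)) Dom t)
    (hx0 : 0 ≤ h (x 0)) :
    ∀ t ∈ Dom, 0 ≤ h (x t) := by
  intro t ht
  have ht' := ht
  rw [hDom] at ht'
  obtain ⟨ht0, htT⟩ := ht'
  have hsub : Set.Icc 0 t ⊆ Dom := by
    intro s hs
    rw [hDom]
    exact ⟨hs.1, (EReal.coe_le_coe_iff.2 hs.2).trans_lt htT⟩
  have hder : ∀ s ∈ Dom, HasDerivWithinAt (fun r => h (x r)) (fderiv ℝ h (x s) (f (x s))) Dom s :=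
    fun s hs => ((hh.differentiable one_ne_zero (x s)).hasFDerivAt).comp_hasDerivWithinAt s (hx s hs)
  refine nonneg_of_deriv_right_pos_of_neg (y' := fun s => fderiv ℝ h (x s) (f (x s)))
    (fun s hs => ((hder s (hsub hs)).continuousWithinAt).mono hsub)
    (fun s hs => ?_) hx0 (fun s _ hneg => ?_) t ⟨ht0, le_rfl⟩
  · refine (hder s (hsub ⟨hs.1, hs.2.le⟩)).mono_of_mem_nhdsWithin ?_
    exact Filter.mem_of_superset (Icc_mem_nhdsGE hs.2)
      ((Set.Icc_subset_Icc_left hs.1).trans hsub)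
  · have hα : α (h (x s)) < 0 := hα0 ▸ hαm hneg
    linarith [hcbf (x s)]
end

section
/- Let α : ℝ → ℝ be locally Lipschitz, strictly increasing, and satisfy α(0) = 0. Let T ∈ (0, ∞] and let φ : [0,T) → ℝ be differentiable with φ'(t) ≥ −α(φ(t)) for all t ∈ [0,T) and φ(0) ≥ 0. Then φ(t) ≥ 0 for all t ∈ [0,T). -/
/-- **Scalar comparison lemma for CBFs.** If `α` is locally Lipschitz,
strictly increasing with `α(0) = 0`, and `φ : [0,T) → ℝ` (`T ∈ (0,∞]`) is
differentiable with `φ'(t) ≥ −α(φ(t))` and `φ(0) ≥ 0`, then `φ(t) ≥ 0` for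
all `t ∈ [0,T)`. -/
theorem scalar_comparison_cbf
    (α : ℝ → ℝ)
    (hαlip : LocallyLipschitz α) (hαm : StrictMono α) (hα0 : α 0 = 0)
    (T : EReal) (hT : 0 < T)
    (Dom : Set ℝ) (hDom : Dom = {t : ℝ | 0 ≤ t ∧ (t : EReal) < T})
    (φ φ' : ℝ → ℝ)
    (hφ : ∀ t ∈ Dom, HasDerivWithinAt φ (φ' t) Dom t)
    (hineq : ∀ t ∈ Dom, -α (φ t) ≤ φ' t)
    (hφ0 : 0 ≤ φ 0) :
    ∀ t ∈ Dom, 0 ≤ φ t := by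
  subst hDom
  intro t ht
  have hIcc : Set.Icc 0 t ⊆ {t : ℝ | 0 ≤ t ∧ (t : EReal) < T} := fun x hx =>
    ⟨hx.1, (EReal.coe_le_coe_iff.2 hx.2).trans_lt ht.2⟩
  refine neg_nonpos.1 (le_of_forall_pos_le_add fun ε hε => ?_)
  rw [zero_add]
  refine image_le_of_deriv_right_lt_deriv_boundary (f := fun x => -φ x)
    (f' := fun x => -φ' x) (B := fun _ => ε) (B' := fun _ => 0) (a := 0) (b := t)
    (fun x hx => ((hφ x (hIcc hx)).continuousWithinAt.mono hIcc).neg)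
    (fun x hx => ?_) (by linarith) (fun x => hasDerivAt_const x ε)
    (fun x hx hxε => ?_) (Set.right_mem_Icc.2 ht.1)
  · refine ((hφ x (hIcc ⟨hx.1, hx.2.le⟩)).mono_of_mem_nhdsWithin ?_).neg
    exact Filter.mem_of_superset (Icc_mem_nhdsGE hx.2)
      ((Set.Icc_subset_Icc_left hx.1).trans hIcc)
  · have hneg : α (φ x) < 0 := by
      rw [← hα0]
      exact hαm (by linarith)
    linarith [hineq x (hIcc ⟨hx.1, hx.2.le⟩)]
end
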